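/- Let f₁₁ ∈ ℚ[x] be the polynomial f₁₁(x) = x^11 + 2x^10 - 5x^9 + 50x^8 + 70x^7 - 232x^6 + 796x^5 + 1400x^4 - 5075x^3 + 10950x^2 + 2805x - 90. Then the Galois group of f₁₁ over ℚ has cardinality 7920 (the order of the Mathieu group M₁₁). -/

import Mathlib

open Polynomial

/-- The first generator of a copy of `M₁₁`, an 11-cycle. -/
def rot : Equiv.Perm (Fin 11) := Equiv.addRight 1

/-- The second generator of a copy of `M₁₁`, an 11-cycle. -/
def twist : Equiv.Perm (Fin 11) where
  toFun := ![10, 0, 1, 6, 2, 9, 7, 8, 4, 3, 5]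
  invFun := ![1, 2, 4, 9, 8, 10, 3, 6, 7, 5, 0]
  left_inv := by decide
  right_inv := by decide

lemma rot_pow : rot ^ 11 = 1 := by
  ext i; revert i; decide

lemma twist_pow : twist ^ 11 = 1 := by
  ext i; revert i; decide

/-- The pointwise stabilizer of `0, 1, 2, 3`. -/
def fixFour : Subgroup (Equiv.Perm (Fin 11)) where
  carrier := {σ | ∀ i, i < 4 → σ i = i}
  mul_mem' {σ τ} hσ hτ i hi := by rw [Equiv.Perm.mul_apply, hτ i hi, hσ i hi]
  one_mem' _ _ := rfl
  inv_mem' {σ} hσ i hi := by rw [Equiv.Perm.inv_eq_iff_eq, hσ i hi]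

lemma mem_fixFour {σ : Equiv.Perm (Fin 11)} : σ ∈ fixFour ↔ ∀ i, i < 4 → σ i = i := Iff.rfl

lemma card_fixFour : Nat.card fixFour = 5040 := by
  have e : fixFour ≃ Equiv.Perm {i : Fin 11 // ¬ i < 4} :=
    ((Equiv.Perm.subtypeEquivSubtypePerm (fun i : Fin 11 ↦ ¬ i < 4)).trans
      (Equiv.subtypeEquivRight fun σ ↦ by simp [mem_fixFour])).symm
  rw [Nat.card_congr e, Nat.card_perm, Nat.card_eq_fintype_card]
  have : Fintype.card {i : Fin 11 // ¬ i < 4} = 7 := by decide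
  rw [this]; rfl

/-- The product of the generators prescribed by a word (`true` is `rot`, `false` is `twist`). -/
def word (w : List Bool) : Equiv.Perm (Fin 11) := (w.map fun b ↦ cond b rot twist).prod

lemma word_mem {K : Subgroup (Equiv.Perm (Fin 11))} (hr : rot ∈ K) (ht : twist ∈ K)
    (w : List Bool) : word w ∈ K := by
  refine K.list_prod_mem fun x hx ↦ ?_
  obtain ⟨b, -, rfl⟩ := List.mem_map.1 hx
  cases b
  · exact ht
  · exact hr

/-- Words witnessing that `rot` and `twist` generate a 4-transitive group. -/
def transversal : List (List Bool) :=
  [[], [false], [false, false], [false, false, false, true], [false, false, false],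
   [true, true, false], [true, true, true, true, true], [true, true, true, true],
   [true, true, true], [true, true], [true], [false, false, true, true],
   [false, false, true, true, false, true], [false, false, false, true, true, true, true],
   [false, false, true, false, true, false, true, true],
   [true, true, false, true, true, true, true, true], [false, false, true, false, true, true],
   [false, false, true, true, false, true, false, true],
   [true, true, true, true, true, true, false, false],
   [true, true, true, false, false, true, false, false], [false, true], [false, true, true, false],
   [false, true, true, false, false, true, false, true], [false, true, false, true, false, true],
   [false, true, true, false, false, true], [false, true, false, true],
   [false, true, true, false, true, false], [false, true, false, true, false, true, true, false],
   [true, false], [false, true, false, true, true, false, false, true, true, false],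
   [true, false, false, true, false, true, true, false, false, true],
   [true, false, true, false, true, false],
   [true, true, false, true, false, false, true, true, false, false], [true, false, true, false],
   [false, true, false, true, true, false, false, true]]

lemma exists_word : ∀ j : Fin 11, j < 4 → ∀ i : Fin 11, j ≤ i →
    ∃ w ∈ transversal, (∀ l, l < j → word w l = l) ∧ word w i = j := by
  decide +kernel

lemma exists_mul_fix {K : Subgroup (Equiv.Perm (Fin 11))} (hr : rot ∈ K) (ht : twist ∈ K)
    (σ : Equiv.Perm (Fin 11)) (n : ℕ) (hn : n ≤ 4) :
    ∃ k ∈ K, ∀ i : Fin 11, (i : ℕ) < n → (k * σ) i = i := by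
  induction n with
  | zero => exact ⟨1, K.one_mem, by simp⟩
  | succ n ih =>
    obtain ⟨k, hk, hfix⟩ := ih (by omega)
    let j : Fin 11 := ⟨n, by omega⟩
    have hj : j ≤ (k * σ) j := by
      by_contra! hlt
      have h1 := hfix _ (show (((k * σ) j : Fin 11) : ℕ) < n from hlt)
      have h2 := (k * σ).injective h1
      rw [h2] at hlt
      exact lt_irrefl _ hlt
    obtain ⟨w, -, hw, hwj⟩ := exists_word j (by rw [Fin.lt_def]; exact hn) _ hj
    refine ⟨word w * k, K.mul_mem (word_mem hr ht w) hk, fun i hi ↦ ?_⟩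
    rw [mul_assoc, Equiv.Perm.mul_apply]
    rcases Nat.lt_succ_iff_lt_or_eq.1 hi with h | h
    · rw [hfix i h]
      exact hw i h
    · obtain rfl : i = j := Fin.ext h
      exact hwj

lemma exists_mul_mem_fixFour {K : Subgroup (Equiv.Perm (Fin 11))} (hr : rot ∈ K) (ht : twist ∈ K)
    (σ : Equiv.Perm (Fin 11)) : ∃ k ∈ K, k * σ ∈ fixFour := by
  obtain ⟨k, hk, h⟩ := exists_mul_fix hr ht σ 4 le_rfl
  exact ⟨k, hk, fun i hi ↦ h i hi⟩

open scoped Pointwise in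
/-- A subgroup containing both generators and meeting `fixFour` trivially is sharply
4-transitive. -/
lemma card_eq_of_disjoint {K : Subgroup (Equiv.Perm (Fin 11))} (hr : rot ∈ K) (ht : twist ∈ K)
    (hK : Disjoint K fixFour) : Nat.card K = 7920 := by
  have hmul : (K : Set (Equiv.Perm (Fin 11))) * (fixFour : Set (Equiv.Perm (Fin 11))) =
      Set.univ := by
    refine Set.eq_univ_of_forall fun σ ↦ ?_
    obtain ⟨k, hk, h⟩ := exists_mul_mem_fixFour hr ht σ
    exact Set.mem_mul.2 ⟨k⁻¹, K.inv_mem hk, k * σ, h, by group⟩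
  have := (Subgroup.isComplement'_of_disjoint_and_mul_eq_univ hK hmul).card_mul_card
  rw [card_fixFour, Nat.card_perm, Nat.card_eq_fintype_card (α := Fin 11), Fintype.card_fin,
    show Nat.factorial 11 = 7920 * 5040 from rfl] at this
  exact Nat.eq_of_mul_eq_mul_right (by norm_num) this

lemma mem_of_pow_eleven_eq_one {G : Type*} [Group G] {H M : Subgroup G} (h0 : H.relIndex M ≠ 0)
    (h10 : H.relIndex M ≤ 10) {a : G} (ha : a ∈ M) (h11 : a ^ 11 = 1) : a ∈ H := by
  obtain ⟨n, hpos, hn, hmem⟩ := Subgroup.exists_pow_mem_of_relIndex_ne_zero h0 ha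
  have hcop : Nat.gcd n 11 = 1 :=
    ((Nat.Prime.coprime_iff_not_dvd (by norm_num)).2
      (Nat.not_dvd_of_pos_of_lt hpos (by omega))).symm
  have hz : a ^ (Nat.gcd n 11 : ℤ) ∈ H := by
    rw [Nat.gcd_eq_gcd_ab, zpow_add, zpow_mul, zpow_mul, zpow_natCast, zpow_natCast, h11,
      one_zpow, mul_one]
    exact H.zpow_mem hmem.1 _
  simpa [hcop] using hz

/-- A subgroup of order divisible by 1320 of a group of degree 11 that contains both generators and
meets `fixFour` trivially has order 7920. -/
lemma card_eq_of_le {H M : Subgroup (Equiv.Perm (Fin 11))} (hr : rot ∈ M) (ht : twist ∈ M)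
    (hM : Disjoint M fixFour) (hH : H ≤ M) (hdvd : 1320 ∣ Nat.card H) : Nat.card H = 7920 := by
  have hcard := card_eq_of_disjoint hr ht hM
  have hmul : Nat.card H * H.relIndex M = 7920 := by
    rw [← hcard, ← Subgroup.relIndex_bot_left, ← Subgroup.relIndex_bot_left,
      Subgroup.relIndex_mul_relIndex _ _ _ bot_le hH]
  have h0 : H.relIndex M ≠ 0 := by rintro h; simp [h] at hmul
  have h10 : H.relIndex M ≤ 10 := by
    have hpos : 0 < Nat.card H := Nat.card_pos
    have := Nat.le_of_dvd hpos hdvd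
    by_contra! hlt
    nlinarith
  exact card_eq_of_disjoint (mem_of_pow_eleven_eq_one h0 h10 hr rot_pow)
    (mem_of_pow_eleven_eq_one h0 h10 ht twist_pow) (hM.mono_left hH)

/-- The sum over the 66 blocks of a Steiner system `S(4, 5, 11)` of the products of the variables
indexed by a block. -/
def steinerForm {R : Type*} [CommSemiring R] (x : Fin 11 → R) : R :=
  ∑ s, x s * x (s + 1) *
    (x (s + 2) * (x (s + 3) * x (s + 9) + x (s + 4) * x (s + 7) + x (s + 5) * x (s + 6)) +
      x (s + 3) * (x (s + 4) * x (s + 8) + x (s + 5) * x (s + 7)) +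
      x (s + 4) * x (s + 6) * x (s + 9))

/-- `steinerForm` in a shape that is cheap to evaluate. -/
def steinerNested {R : Type*} [Add R] [Mul R] (x0 x1 x2 x3 x4 x5 x6 x7 x8 x9 x10 : R) : R :=
    x0 * (x1 * (x2 * (x3 * x9 + x8 * x10 + x4 * x7 + x5 * x6) + x3 * (x6 * x10 + x4 * x8 + x5 *
    x7) + x9 * (x7 * x10 + x5 * x8 + x4 * x6) + x6 * x7 * x8 + x4 * x5 * x10) + x2 * (x3 * (x4 *
    x5 + x7 * x10 + x6 * x8) + x9 * (x5 * x10 + x6 * x7 + x4 * x8) + x4 * x6 * x10 + x5 * x7 * x8)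
    + x3 * (x9 * (x7 * x8 + x4 * x10 + x5 * x6) + x4 * x6 * x7 + x5 * x8 * x10) + x4 * (x5 * (x6 *
    x8 + x7 * x9) + x7 * x8 * x10) + x6 * (x10 * (x8 * x9 + x5 * x7))) + x1 * (x2 * (x3 * (x4 *
    x10 + x5 * x8 + x6 * x7) + x9 * (x7 * x8 + x4 * x5 + x6 * x10) + x4 * x6 * x8 + x5 * x7 * x10)
    + x3 * (x9 * (x5 * x10 + x4 * x7 + x6 * x8) + x4 * x5 * x6 + x7 * x8 * x10) + x4 * (x7 * (x5 *
    x8 + x6 * x10) + x8 * x9 * x10) + x5 * (x6 * (x7 * x9 + x8 * x10))) + x2 * (x3 * (x9 * (x4 *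
    x6 + x8 * x10 + x5 * x7) + x4 * x7 * x8 + x5 * x6 * x10) + x4 * (x5 * (x6 * x7 + x8 * x10) +
    x7 * x9 * x10) + x6 * (x8 * (x7 * x10 + x5 * x9))) + x3 * (x4 * (x5 * (x7 * x10 + x8 * x9) +
    x6 * x8 * x10) + x6 * (x7 * (x5 * x8 + x9 * x10))) + x9 * (x4 * (x6 * (x7 * x8 + x5 * x10)) +
    x5 * x7 * x8 * x10)

lemma steinerForm_eq_nested {R : Type*} [CommSemiring R] (x : Fin 11 → R) :
    steinerForm x = steinerNested (x 0) (x 1) (x 2) (x 3) (x 4) (x 5) (x 6) (x 7) (x 8) (x 9)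
      (x 10) := by
  have h : Finset.univ = ([0, 1, 2, 3, 4, 5, 6, 7, 8, 9, 10] : List (Fin 11)).toFinset := by decide
  rw [steinerForm, h, List.sum_toFinset _ (by decide)]
  simp only [List.map_cons, List.map_nil, List.sum_cons, List.sum_nil, Fin.reduceAdd, steinerNested]
  ring

lemma map_steinerForm {R S : Type*} [CommSemiring R] [CommSemiring S] (φ : R →+* S)
    (x : Fin 11 → R) : φ (steinerForm x) = steinerForm (fun i ↦ φ (x i)) := by
  simp [steinerForm]

/-- The permutations of the variables that fix `steinerForm`. -/
def steinerGroup : Subgroup (Equiv.Perm (Fin 11)) where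
  carrier := {σ | ∀ (R : Type) [CommRing R] (x : Fin 11 → R),
    steinerForm (fun i ↦ x (σ i)) = steinerForm x}
  mul_mem' {σ τ} hσ hτ R _ x := (hτ R fun i ↦ x (σ i)).trans (hσ R x)
  one_mem' _ _ _ := rfl
  inv_mem' {σ} hσ R _ x := by simpa using (hσ R fun i ↦ x (σ⁻¹ i)).symm

lemma rot_mem_steinerGroup : rot ∈ steinerGroup := by
  intro R _ x
  simp only [steinerForm]
  refine Fintype.sum_equiv rot _ _ fun s ↦ ?_
  simp only [rot, Equiv.coe_addRight, add_right_comm s _ 1]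

lemma twist_mem_steinerGroup : twist ∈ steinerGroup := by
  intro R _ x
  rw [steinerForm_eq_nested, steinerForm_eq_nested]
  simp only [twist, Equiv.coe_fn_mk, steinerNested]
  simp only [Matrix.cons_val]
  ring

/-- Residues modulo `11047 ^ 2` of the roots of the polynomial, numbered so that `steinerForm` takes
the value `-548`. -/
def residue : Fin 11 → ℕ :=
  ![79970544, 85096714, 118050615, 44856539, 64865586, 30230341, 5730759, 19804592, 44496019,
    14644335, 102434999]

lemma residue_injective : Function.Injective residue := by decide +kernel

/-- `steinerNested` with its first four arguments specialized to residues. -/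
def nestedTail : List ℕ → ℕ
  | [x4, x5, x6, x7, x8, x9, x10] =>
    steinerNested 79970544 85096714 118050615 44856539 x4 x5 x6 x7 x8 x9 x10
  | _ => 0

lemma eq_of_mem_permutations : ∀ t ∈ List.permutations' [30230341, 5730759, 19804592, 44496019,
      14644335, 102434999], ∀ l ∈ List.permutations'Aux 64865586 t,
    nestedTail l % 11047 ^ 2 = 122035661 →
      l = [64865586, 30230341, 5730759, 19804592, 44496019, 14644335, 102434999] := by
  decide +kernel

lemma eq_one_of_steinerForm_residue {τ : Equiv.Perm (Fin 11)} (hτ : τ ∈ fixFour)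
    (h : steinerForm (fun i ↦ residue (τ i)) % 11047 ^ 2 = 122035661) : τ = 1 := by
  have hsmall : ∀ i : Fin 11, i < 4 → residue (τ i) = residue i := fun i hi ↦ by rw [hτ i hi]
  rw [steinerForm_eq_nested, hsmall 0 (by decide), hsmall 1 (by decide), hsmall 2 (by decide),
    hsmall 3 (by decide)] at h
  have hτ' : ∀ i : Fin 11, ¬ i < 4 → ¬ τ i < 4 := fun i hi hlt ↦
    hi (τ.injective (hτ _ hlt) ▸ hlt)
  have hperm : List.Perm (List.map (fun i ↦ τ i) [4, 5, 6, 7, 8, 9, 10])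
      [4, 5, 6, 7, 8, 9, 10] := by
    refine (List.perm_ext_iff_of_nodup (List.Nodup.map τ.injective (by decide)) (by decide)).2
      fun i ↦ ?_
    have hmem : ∀ i : Fin 11, i ∈ ([4, 5, 6, 7, 8, 9, 10] : List (Fin 11)) ↔ ¬ i < 4 := by decide
    rw [hmem, List.mem_map]
    refine ⟨?_, fun hi ↦ ⟨τ⁻¹ i, (hmem _).2 fun hlt ↦ ?_, by simp⟩⟩
    · rintro ⟨j, hj, rfl⟩
      exact hτ' j ((hmem j).1 hj)
    · have := hτ _ hlt
      rw [← Equiv.Perm.mul_apply, mul_inv_cancel, Equiv.Perm.one_apply] at this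
      exact hi (this ▸ hlt)
  obtain ⟨t, ht, hmem⟩ := List.mem_flatMap.1 (List.mem_permutations'.2 (hperm.map residue))
  have hl := eq_of_mem_permutations t ht _ hmem h
  have hlarge : ∀ i ∈ ([4, 5, 6, 7, 8, 9, 10] : List (Fin 11)), residue (τ i) = residue i := by
    have := List.map_inj_left (l := ([4, 5, 6, 7, 8, 9, 10] : List (Fin 11)))
      (f := fun i ↦ residue (τ i)) (g := residue)
    exact this.1 hl
  ext i : 1
  by_cases hi : i < 4
  · exact hτ i hi
  · refine residue_injective (hlarge i ?_)
    revert hi; revert i; decide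

/-- The polynomial under consideration, over `ℤ`. -/
noncomputable def fInt : ℤ[X] :=
  X ^ 11 + 2 * X ^ 10 - 5 * X ^ 9 + 50 * X ^ 8 + 70 * X ^ 7 - 232 * X ^ 6
    + 796 * X ^ 5 + 1400 * X ^ 4 - 5075 * X ^ 3 + 10950 * X ^ 2 + 2805 * X - 90

/-- The terms of `fInt` with positive coefficients. -/
def posTerms (x : ℕ) : ℕ :=
  x ^ 11 + 2 * x ^ 10 + 50 * x ^ 8 + 70 * x ^ 7 + 796 * x ^ 5 + 1400 * x ^ 4 + 10950 * x ^ 2 +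
    2805 * x

/-- The terms of `fInt` with negative coefficients. -/
def negTerms (x : ℕ) : ℕ := 5 * x ^ 9 + 232 * x ^ 6 + 5075 * x ^ 3 + 90

/-- The derivative of `posTerms`. -/
def posDeriv (x : ℕ) : ℕ :=
  11 * x ^ 10 + 20 * x ^ 9 + 400 * x ^ 7 + 490 * x ^ 6 + 3980 * x ^ 4 + 5600 * x ^ 3 + 21900 * x +
    2805

/-- The derivative of `negTerms`. -/
def negDeriv (x : ℕ) : ℕ := 45 * x ^ 8 + 1392 * x ^ 5 + 15225 * x ^ 2

/-- One step of Newton's method modulo `m`, from an approximate root and an approximate inverse of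
the derivative there. -/
def newtonStep (m : ℕ) (z : ℕ × ℕ) : ℕ × ℕ :=
  let x := (z.1 + z.2 * (negTerms z.1 + (m - posTerms z.1 % m))) % m
  (x, z.2 * (2 + z.2 * (negDeriv x + (m - posDeriv x % m))) % m)

/-- Iterated Newton steps, doubling the `11047`-adic precision each time. -/
def newton (z : ℕ × ℕ) : ℕ → ℕ × ℕ
  | 0 => z
  | n + 1 => newtonStep (11047 ^ 2 ^ (n + 1)) (newton z n)

/-- Inverses modulo `11047` of the derivative at the roots. -/
def derivInverse : Fin 11 → ℕ :=
  ![4402, 5935, 8883, 3438, 6209, 10513, 1078, 5666, 4017, 2693, 2401]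

/-- The roots modulo `11047 ^ 8192`. -/
def approx (i : Fin 11) : ℕ := (newton (residue i % 11047, derivInverse i) 13).1

/-- The `11047`-adic precision that is needed. -/
@[irreducible] def precision : ℕ := 7120

lemma approx_spec :
    (∀ i, posTerms (approx i) % 11047 ^ precision = negTerms (approx i) % 11047 ^ precision ∧
      approx i % 11047 ^ 2 = residue i) ∧
    (steinerNested (approx 0) (approx 1) (approx 2) (approx 3) (approx 4) (approx 5) (approx 6)
      (approx 7) (approx 8) (approx 9) (approx 10) + 548) % 11047 ^ precision = 0 := by
  decide +kernel

lemma not_dvd_deriv_residue : ∀ i, posDeriv (residue i) % 11047 ≠ negDeriv (residue i) % 11047 := by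
  decide +kernel

lemma exists_padic_root {p : ℕ} [Fact p.Prime] (F : ℤ[X]) (a : ℤ_[p]) {n : ℕ} (hn : n ≠ 0)
    (h : (p : ℤ_[p]) ^ n ∣ aeval a F) (hd : ‖aeval a (derivative F)‖ = 1) :
    ∃ ρ : ℤ_[p], aeval ρ F = 0 ∧ (p : ℤ_[p]) ^ n ∣ ρ - a := by
  have hlt : ‖aeval a F‖ < ‖aeval a (derivative F)‖ ^ 2 := by
    rw [hd, one_pow, PadicInt.norm_lt_one_iff_dvd]
    exact (dvd_pow_self _ hn).trans h
  obtain ⟨ρ, hρ, hclose, -, -⟩ := hensels_lemma hlt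
  rw [hd] at hclose
  refine ⟨ρ, hρ, ?_⟩
  obtain ⟨k, hk⟩ := (F.map (algebraMap ℤ ℤ_[p])).binomExpansion a (ρ - a)
  rw [add_sub_cancel, derivative_map, eval_map_algebraMap, eval_map_algebraMap,
    eval_map_algebraMap, hρ] at hk
  have hunit : IsUnit (aeval a (derivative F) + k * (ρ - a)) := by
    rw [PadicInt.isUnit_iff, PadicInt.norm_add_eq_max_of_ne, hd]
    · exact max_eq_left (PadicInt.norm_lt_one_mul hclose).le
    · rw [hd]
      exact (PadicInt.norm_lt_one_mul hclose).ne'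
  have hprod : (ρ - a) * (aeval a (derivative F) + k * (ρ - a)) = -aeval a F := by
    linear_combination -hk
  exact hunit.dvd_mul_right.1 (hprod ▸ (dvd_neg.2 h))

instance fact_prime_11047 : Fact (Nat.Prime 11047) := ⟨by norm_num⟩

lemma aeval_fInt {R : Type*} [CommRing R] (a : ℕ) :
    aeval (a : R) fInt = posTerms a - negTerms a := by
  simp [fInt, posTerms, negTerms, map_ofNat]
  ring

lemma aeval_derivative_fInt {R : Type*} [CommRing R] (a : ℕ) :
    aeval (a : R) (derivative fInt) = posDeriv a - negDeriv a := by
  simp [fInt, posDeriv, negDeriv, map_ofNat]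
  ring

lemma exists_root_near_approx (i : Fin 11) :
    ∃ ρ : ℤ_[11047], aeval ρ fInt = 0 ∧ PadicInt.toZModPow precision ρ = approx i := by
  obtain ⟨h, hres⟩ := approx_spec.1 i
  have hmod : ∀ m, m ∣ 11047 ^ 2 → approx i ≡ residue i [MOD m] := fun m hm ↦ by
    rw [← hres]
    exact ((Nat.mod_modEq _ _).symm).of_dvd hm
  obtain ⟨ρ, hρ, hdvd⟩ := exists_padic_root fInt (approx i : ℤ_[11047]) (n := precision)
    (by decide +kernel)
    (by
      rw [aeval_fInt, ← Ideal.mem_span_singleton, ← PadicInt.ker_toZModPow, RingHom.mem_ker,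
        map_sub, map_natCast, map_natCast, sub_eq_zero]
      exact (ZMod.natCast_eq_natCast_iff' _ _ _).2 h)
    (by
      have hcast : aeval (approx i : ℤ_[11047]) (derivative fInt) =
          ((posDeriv (approx i) - negDeriv (approx i) : ℤ) : ℤ_[11047]) := by
        rw [aeval_derivative_fInt]
        push_cast
        rfl
      rw [hcast, ← PadicInt.isUnit_iff]
      by_contra hnot
      rw [PadicInt.not_isUnit_iff, PadicInt.norm_int_lt_one_iff_dvd] at hnot
      have hm := hmod 11047 (dvd_pow_self _ two_ne_zero)
      refine not_dvd_deriv_residue i (Nat.ModEq.trans (Nat.ModEq.trans ?_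
        (((Nat.modEq_iff_dvd (n := 11047)).2 hnot).symm)) ?_)
      · unfold posDeriv
        gcongr
      · unfold negDeriv
        gcongr)
  refine ⟨ρ, hρ, ?_⟩
  rw [← Ideal.mem_span_singleton, ← PadicInt.ker_toZModPow, RingHom.mem_ker, map_sub, map_natCast,
    sub_eq_zero] at hdvd
  exact hdvd

/-- The `11047`-adic roots of the polynomial. -/
noncomputable def padicRoot (i : Fin 11) : ℤ_[11047] := (exists_root_near_approx i).choose

lemma aeval_padicRoot (i : Fin 11) : aeval (padicRoot i) fInt = 0 :=
  (exists_root_near_approx i).choose_spec.1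

lemma toZModPow_padicRoot (i : Fin 11) : PadicInt.toZModPow precision (padicRoot i) = approx i :=
  (exists_root_near_approx i).choose_spec.2

lemma toZModPow_two_padicRoot (i : Fin 11) :
    PadicInt.toZModPow 2 (padicRoot i) = residue i := by
  rw [← PadicInt.zmod_cast_comp_toZModPow 2 precision (by decide +kernel), RingHom.comp_apply,
    toZModPow_padicRoot, map_natCast, ← (approx_spec.1 i).2]
  exact (ZMod.natCast_mod _ _).symm

lemma padicRoot_injective : Function.Injective padicRoot := by
  intro i j hij
  have h : ((residue i : ℕ) : ZMod (11047 ^ 2)) = (residue j : ℕ) := by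
    rw [← toZModPow_two_padicRoot, ← toZModPow_two_padicRoot, hij]
  rw [ZMod.natCast_eq_natCast_iff'] at h
  have hlt : ∀ i, residue i % 11047 ^ 2 = residue i := by decide +kernel
  rw [hlt, hlt] at h
  exact residue_injective h

/-- The roots satisfy the invariant equation to high `11047`-adic accuracy. -/
lemma norm_steinerForm_padicRoot :
    ‖steinerForm padicRoot + 548‖ ≤ (11047 : ℝ) ^ (-(precision : ℤ)) := by
  have h : steinerForm padicRoot + 548 ∈ RingHom.ker (PadicInt.toZModPow (p := 11047) precision) := by
    rw [RingHom.mem_ker, map_add, map_steinerForm, map_ofNat]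
    simp only [toZModPow_padicRoot]
    have hcast := map_steinerForm (Nat.castRingHom (ZMod (11047 ^ precision))) approx
    simp only [Nat.coe_castRingHom] at hcast
    rw [← hcast, steinerForm_eq_nested]
    have := (ZMod.natCast_eq_zero_iff _ _).2 (Nat.dvd_of_mod_eq_zero approx_spec.2)
    rwa [Nat.cast_add, Nat.cast_ofNat] at this
  rw [PadicInt.ker_toZModPow] at h
  exact_mod_cast (PadicInt.norm_le_pow_iff_mem_span_pow _ precision).2 h

/-- The invariant equation pins down the numbering of the last seven roots. -/
lemma eq_one_of_steinerForm_padicRoot {τ : Equiv.Perm (Fin 11)} (hτ : τ ∈ fixFour)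
    (h : steinerForm (fun i ↦ padicRoot (τ i)) = -548) : τ = 1 := by
  refine eq_one_of_steinerForm_residue hτ ?_
  have h2 := congrArg (PadicInt.toZModPow 2) h
  rw [map_steinerForm] at h2
  simp only [toZModPow_two_padicRoot] at h2
  have hcast := map_steinerForm (Nat.castRingHom (ZMod (11047 ^ 2))) fun i ↦ residue (τ i)
  simp only [Nat.coe_castRingHom] at hcast
  rw [← hcast, map_neg, map_ofNat] at h2
  have h3 : ((steinerForm fun i ↦ residue (τ i) : ℕ) : ZMod (11047 ^ 2)) = (122035661 : ℕ) := by
    rw [h2]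
    decide +kernel
  rw [ZMod.natCast_eq_natCast_iff'] at h3
  exact h3

/-- The value at `α` of the polynomial with natural number coefficients `l`, leading one first. -/
def evalList {R : Type*} [Semiring R] (α : R) : List ℕ → R
  | [] => 0
  | c :: l => c * α ^ l.length + evalList α l

/-- The sum `a + c * b` of coefficient lists modulo `p`. -/
def addMulMod (p c : ℕ) (a b : List ℕ) : List ℕ := List.zipWith (fun x y ↦ (x + c * y) % p) a b

/-- Multiplication by the variable, where the variable to the power `t.length` is `t`. -/
def shiftMod (p : ℕ) (t : List ℕ) : List ℕ → List ℕ
  | [] => []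
  | c :: l => addMulMod p c (l ++ [0]) t

/-- Multiplication of coefficient lists, where the variable to the power `t.length` is `t`. -/
def mulMod (p : ℕ) (t a b : List ℕ) : List ℕ :=
  a.foldl (fun acc c ↦ addMulMod p c (shiftMod p t acc) b) (List.replicate t.length 0)

/-- The coefficient list of `1`. -/
def oneList (n : ℕ) : List ℕ := List.replicate (n - 1) 0 ++ [1]

/-- The coefficient list of the variable. -/
def varList (n : ℕ) : List ℕ := List.replicate (n - 2) 0 ++ [1, 0]

/-- The coefficient list of the `p ^ e`-th power of the variable. -/
def frobList (p : ℕ) (t : List ℕ) (e : ℕ) : List ℕ :=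
  (fun a ↦ (mulMod p t a)^[p] (oneList t.length))^[e] (varList t.length)

section

variable {R : Type*} [CommRing R] {p : ℕ} {α : R} {t : List ℕ}

lemma evalList_append (l₁ l₂ : List ℕ) :
    evalList α (l₁ ++ l₂) = evalList α l₁ * α ^ l₂.length + evalList α l₂ := by
  induction l₁ with
  | nil => simp [evalList]
  | cons c l ih => simp [evalList, ih]; ring

lemma evalList_replicate_zero (n : ℕ) : evalList α (List.replicate n 0) = 0 := by
  induction n with
  | zero => rfl
  | succ n ih => simp [List.replicate_succ, evalList, ih]

lemma evalList_oneList (n : ℕ) : evalList α (oneList n) = 1 := by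
  simp [oneList, evalList_append, evalList_replicate_zero, evalList]

lemma evalList_varList (n : ℕ) : evalList α (varList n) = α := by
  simp [varList, evalList_append, evalList_replicate_zero, evalList]

lemma length_addMulMod {c : ℕ} {a b : List ℕ} (h : a.length = b.length) :
    (addMulMod p c a b).length = b.length := by
  simp [addMulMod, h]

lemma evalList_addMulMod (hp : (p : R) = 0) (c : ℕ) {a b : List ℕ} (h : a.length = b.length) :
    evalList α (addMulMod p c a b) = evalList α a + c * evalList α b := by
  induction a generalizing b with
  | nil => cases b <;> simp_all [evalList, addMulMod]
  | cons x a ih =>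
    cases b with
    | nil => simp at h
    | cons y b =>
      have hab : a.length = b.length := by simpa using h
      have hmod : ((x + c * y : ℕ) : R) = (((x + c * y) % p : ℕ) : R) := by
        conv_lhs => rw [← Nat.div_add_mod (x + c * y) p]
        push_cast
        rw [hp]
        ring
      have hlen := length_addMulMod (p := p) (c := c) hab
      have hcons : addMulMod p c (x :: a) (y :: b) = ((x + c * y) % p) :: addMulMod p c a b := rfl
      rw [hcons, evalList, evalList, evalList, ih hab, hlen, ← hmod, hab]
      push_cast
      ring

lemma length_shiftMod {a : List ℕ} (h : a.length = t.length) :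
    (shiftMod p t a).length = t.length := by
  cases a with
  | nil => simpa [shiftMod] using h
  | cons c l => exact length_addMulMod (by simpa using h)

lemma evalList_shiftMod (hp : (p : R) = 0) (ht : α ^ t.length = evalList α t) {a : List ℕ}
    (h : a.length = t.length) : evalList α (shiftMod p t a) = α * evalList α a := by
  cases a with
  | nil => simp [shiftMod, evalList]
  | cons c l =>
    rw [shiftMod, evalList_addMulMod hp c (by simpa using h), ← ht, ← h, evalList_append, evalList]
    simp [evalList]
    ring

lemma foldl_mulMod (hp : (p : R) = 0) (ht : α ^ t.length = evalList α t) (a : List ℕ)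
    {b acc : List ℕ} (hb : b.length = t.length) (hacc : acc.length = t.length) :
    (a.foldl (fun acc c ↦ addMulMod p c (shiftMod p t acc) b) acc).length = t.length ∧
    evalList α (a.foldl (fun acc c ↦ addMulMod p c (shiftMod p t acc) b) acc) =
      evalList α acc * α ^ a.length + evalList α a * evalList α b := by
  induction a generalizing acc with
  | nil => simp [evalList, hacc]
  | cons c l ih =>
    have hlen : (shiftMod p t acc).length = b.length := by rw [length_shiftMod hacc, hb]
    obtain ⟨h₁, h₂⟩ := ih ((length_addMulMod (p := p) (c := c) hlen).trans hb)
    refine ⟨h₁, h₂.trans ?_⟩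
    rw [evalList_addMulMod hp c hlen, evalList_shiftMod hp ht hacc, evalList, List.length_cons]
    ring

lemma mulMod_spec (hp : (p : R) = 0) (ht : α ^ t.length = evalList α t) (a : List ℕ)
    {b : List ℕ} (hb : b.length = t.length) :
    (mulMod p t a b).length = t.length ∧
      evalList α (mulMod p t a b) = evalList α a * evalList α b := by
  have h := foldl_mulMod hp ht a hb (List.length_replicate (n := t.length) (a := 0))
  rwa [evalList_replicate_zero, zero_mul, zero_add] at h

lemma iterate_mulMod_spec (hp : (p : R) = 0) (ht : α ^ t.length = evalList α t)
    (ht0 : 2 ≤ t.length) (a : List ℕ) (n : ℕ) :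
    ((mulMod p t a)^[n] (oneList t.length)).length = t.length ∧
      evalList α ((mulMod p t a)^[n] (oneList t.length)) = evalList α a ^ n := by
  induction n with
  | zero => exact ⟨by simp [oneList]; omega, by simp [evalList_oneList]⟩
  | succ n ih =>
    obtain ⟨h₁, h₂⟩ := mulMod_spec hp ht a ih.1
    rw [Function.iterate_succ_apply', h₁, h₂, ih.2]
    exact ⟨rfl, by ring⟩

lemma frobList_spec (hp : (p : R) = 0) (ht : α ^ t.length = evalList α t)
    (ht0 : 2 ≤ t.length) (e : ℕ) :
    (frobList p t e).length = t.length ∧ evalList α (frobList p t e) = α ^ p ^ e := by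
  induction e with
  | zero => exact ⟨by simp [frobList, varList]; omega, by simp [frobList, evalList_varList]⟩
  | succ e ih =>
    rw [frobList, Function.iterate_succ_apply']
    obtain ⟨h₁, h₂⟩ := iterate_mulMod_spec hp ht ht0 (frobList p t e) p
    refine ⟨h₁, h₂.trans ?_⟩
    rw [ih.2]
    ring

/-- A computational certificate that the roots of `X ^ t.length - t` have degree exactly `d` over
the prime field, the last condition exhibiting an inverse `w` of `α ^ p ^ e - α`. -/
lemma pow_eq_self_and_pow_ne_self [Nontrivial R] {d e : ℕ} {w : List ℕ} (hp : (p : R) = 0)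
    (ht : α ^ t.length = evalList α t) (ht0 : 2 ≤ t.length)
    (hd : frobList p t d = varList t.length)
    (he : mulMod p t w (frobList p t e) =
      addMulMod p 1 (oneList t.length) (mulMod p t w (varList t.length))) :
    α ^ p ^ d = α ∧ α ^ p ^ e ≠ α := by
  have hvar : (varList t.length).length = t.length := by simp [varList]; omega
  have hone : (oneList t.length).length = t.length := by simp [oneList]; omega
  refine ⟨by rw [← (frobList_spec hp ht ht0 d).2, hd, evalList_varList], fun hα ↦ ?_⟩
  obtain ⟨h₁, h₂⟩ := frobList_spec hp ht ht0 e
  have h := congrArg (evalList α) he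
  rw [(mulMod_spec hp ht w h₁).2, h₂, evalList_addMulMod hp 1
    (by rw [hone, (mulMod_spec hp ht w hvar).1]), (mulMod_spec hp ht w hvar).2, evalList_oneList,
    evalList_varList, hα, Nat.cast_one, one_mul, eq_comm, add_eq_right] at h
  exact one_ne_zero h

end

lemma dvd_exponent_of_pow_eq_self {κ : Type*} [Field κ] [Finite κ] {p m q k : ℕ} [Fact q.Prime]
    (hκ : Nat.card κ = p ^ m) {α : κ} (h₁ : α ^ p ^ q ^ (k + 1) = α) (h₂ : α ^ p ^ q ^ k ≠ α) :
    q ^ (k + 1) ∣ m := by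
  have : Fintype κ := Fintype.ofFinite κ
  have hper : ∀ n, Function.IsPeriodicPt (fun x : κ ↦ x ^ p) n α ↔ α ^ p ^ n = α := fun n ↦ by
    rw [Function.IsPeriodicPt, pow_iterate, Function.IsFixedPt]
  rw [← Function.minimalPeriod_eq_prime_pow (mt (hper _).1 h₂) ((hper _).2 h₁),
    ← Function.isPeriodicPt_iff_minimalPeriod_dvd, hper, ← hκ, Nat.card_eq_fintype_card,
    FiniteField.pow_card]

/-- If a factor of `F` modulo `p` only has roots generating extensions of degree divisible by `d`,
then `d` divides the residue degree at `p` of a Galois extension where `F` splits, hence the degree. -/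
lemma dvd_card_galoisGroup (L : Type) [Field L] [CharZero L] [inst : Algebra ℚ L]
    [FiniteDimensional ℚ L] [IsGalois ℚ L] {F h k r : ℤ[X]} (hF : F.Monic)
    (hFL : (F.map (algebraMap ℤ L)).Splits) {p d : ℕ} (hp : p.Prime)
    (hfac : F = h * k + C (p : ℤ) * r) (hh : h.Monic) (hdeg : 0 < h.natDegree)
    (H : ∀ (κ : Type) [Field κ] [Finite κ] (m : ℕ) (α : κ), Nat.card κ = p ^ m → (p : κ) = 0 →
      aeval α h = 0 → d ∣ m) :
    d ∣ Nat.card Gal(L/ℚ) := by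
  obtain rfl : inst = DivisionRing.toRatAlgebra := Subsingleton.elim _ _
  have : NumberField L := ⟨⟩
  have hsplit : (F.map (algebraMap ℤ (NumberField.RingOfIntegers L))).Splits := by
    have hL : ((F.map (algebraMap ℤ (NumberField.RingOfIntegers L))).map
        (algebraMap (NumberField.RingOfIntegers L) L)).Splits := by
      rwa [Polynomial.map_map, RingHom.ext_int ((algebraMap _ L).comp _) (algebraMap ℤ L)]
    refine hL.of_splits_map_of_injective (NumberField.RingOfIntegers.coe_injective) ?_
    intro a ha
    rw [Polynomial.map_map] at ha
    have hroot : aeval a F = 0 := by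
      have := (mem_roots'.1 ha).2
      rwa [IsRoot.def, RingHom.ext_int ((algebraMap _ L).comp _) (algebraMap ℤ L),
        eval_map_algebraMap] at this
    exact ⟨⟨a, F, hF, hroot⟩, rfl⟩
  have hpZ : Prime (p : ℤ) := Nat.prime_iff_prime_int.1 hp
  have : (Ideal.span {(p : ℤ)}).IsPrime := (Ideal.span_singleton_prime hpZ.ne_zero).2 hpZ
  have : (Ideal.span {(p : ℤ)}).IsMaximal :=
    this.isMaximal (by simpa using hp.ne_zero)
  obtain ⟨⟨P, hP, hPp⟩⟩ :=
    (inferInstance : Nonempty (Ideal.primesOver (Ideal.span {(p : ℤ)}) (NumberField.RingOfIntegers L)))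
  have : P.IsMaximal := Ideal.IsMaximal.of_liesOver_isMaximal P (Ideal.span {(p : ℤ)})
  obtain ⟨κ, _, φ, hcard, hpκ⟩ : ∃ (κ : Type) (_ : Field κ) (φ : NumberField.RingOfIntegers L →+* κ),
      Nat.card κ = p ^ Ideal.inertiaDeg' (Ideal.span {(p : ℤ)}) P ∧ (p : κ) = 0 := by
    refine ⟨_, Ideal.Quotient.field P, Ideal.Quotient.mk P, ?_, ?_⟩
    · rw [← Ideal.absNorm_eq_pow_inertiaDeg' P hp]
      rfl
    · have hmem : (p : ℤ) ∈ P.under ℤ := by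
        rw [← hPp.over]
        exact Ideal.mem_span_singleton_self _
      simpa using Ideal.Quotient.eq_zero_iff_mem.2 (Ideal.mem_comap.1 hmem)
  have : Finite κ := Nat.finite_of_card_ne_zero (hcard ▸ pow_ne_zero _ hp.ne_zero)
  obtain ⟨α, hα⟩ : ∃ α : κ, aeval α h = 0 := by
    have hmap : (F.map (algebraMap ℤ (NumberField.RingOfIntegers L))).map φ =
        h.map (algebraMap ℤ κ) * k.map (algebraMap ℤ κ) := by
      rw [Polynomial.map_map, RingHom.ext_int (φ.comp _) (algebraMap ℤ κ), hfac]
      have hpX : (p : κ[X]) = 0 := by rw [← C_eq_natCast, hpκ, C_0]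
      simp [hpX]
    have hne : (F.map (algebraMap ℤ (NumberField.RingOfIntegers L))).map φ ≠ 0 :=
      ((hF.map _).map _).ne_zero
    have hs := (hsplit.map φ).of_dvd hne (hmap ▸ dvd_mul_right _ _)
    obtain ⟨α, hα⟩ := hs.exists_eval_eq_zero (by
      rw [hh.degree_map, degree_eq_natDegree hh.ne_zero]
      exact_mod_cast hdeg.ne')
    exact ⟨α, by rwa [eval_map_algebraMap] at hα⟩
  have hd := H _ _ α hcard hpκ hα
  rw [Ideal.inertiaDeg'_eq_inertiaDeg, ← Ideal.inertiaDegIn_eq_inertiaDeg (Ideal.span {(p : ℤ)}) P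
    Gal(L/ℚ)] at hd
  have := Ideal.ncard_primesOver_mul_ramificationIdxIn_mul_inertiaDegIn (Ideal.span {(p : ℤ)})
    (NumberField.RingOfIntegers L) Gal(L/ℚ)
  rw [← this]
  exact hd.trans ((dvd_mul_left _ _).trans (dvd_mul_left _ _))

/-- The monic polynomial `X ^ t.length - t`. -/
noncomputable def listPoly (t : List ℕ) : ℤ[X] := X ^ t.length - evalList X t

lemma degree_evalList_lt (t : List ℕ) : (evalList (X : ℤ[X]) t).degree < t.length := by
  induction t with
  | nil => simp [evalList]
  | cons c l ih =>
    have hlt : (l.length : WithBot ℕ) < (c :: l).length := by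
      rw [List.length_cons]
      exact_mod_cast Nat.lt_succ_self _
    refine (degree_add_le _ _).trans_lt (max_lt ?_ (ih.trans hlt))
    rw [← C_eq_natCast]
    exact (degree_C_mul_X_pow_le _ _).trans_lt hlt

lemma monic_listPoly (t : List ℕ) : (listPoly t).Monic :=
  monic_X_pow_sub (by simpa using degree_evalList_lt t)

lemma natDegree_listPoly (t : List ℕ) : (listPoly t).natDegree = t.length := by
  have h : (listPoly t).degree = t.length := by
    rw [listPoly, degree_sub_eq_left_of_degree_lt, degree_X_pow]
    rw [degree_X_pow]
    exact degree_evalList_lt t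
  exact natDegree_eq_of_degree_eq_some h

lemma aeval_listPoly {R : Type*} [CommRing R] (α : R) (t : List ℕ) :
    aeval α (listPoly t) = α ^ t.length - evalList α t := by
  have h : ∀ l : List ℕ, aeval α (evalList (X : ℤ[X]) l) = evalList α l := fun l ↦ by
    induction l with
    | nil => simp [evalList]
    | cons c l ih => simp [evalList, ih]
  rw [listPoly, map_sub, h, map_pow, aeval_X]

lemma monic_fInt : fInt.Monic := by
  unfold fInt
  monicity!

/-- A computational certificate for a prime power to divide the order of the Galois group. -/
lemma pow_dvd_card_galoisGroup (L : Type) [Field L] [CharZero L] [Algebra ℚ L]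
    [FiniteDimensional ℚ L] [IsGalois ℚ L] (hL : (fInt.map (algebraMap ℤ L)).Splits)
    {p q k : ℕ} (t w : List ℕ) (g r : ℤ[X]) (hp : p.Prime)
    (hq : q.Prime) (hfac : fInt = listPoly t * g + C (p : ℤ) * r) (ht : 2 ≤ t.length)
    (hd : frobList p t (q ^ (k + 1)) = varList t.length)
    (he : mulMod p t w (frobList p t (q ^ k)) =
      addMulMod p 1 (oneList t.length) (mulMod p t w (varList t.length))) :
    q ^ (k + 1) ∣ Nat.card Gal(L/ℚ) := by
  have : Fact q.Prime := ⟨hq⟩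
  refine dvd_card_galoisGroup L monic_fInt hL hp hfac (monic_listPoly t)
    (by rw [natDegree_listPoly]; omega) fun κ _ _ m α hm hpκ hα ↦ ?_
  rw [aeval_listPoly, sub_eq_zero] at hα
  obtain ⟨h₁, h₂⟩ := pow_eq_self_and_pow_ne_self hpκ hα ht hd he
  exact dvd_exponent_of_pow_eq_self hm h₁ h₂

lemma dvd_card_galoisGroup_fInt (L : Type) [Field L] [CharZero L] [Algebra ℚ L]
    [FiniteDimensional ℚ L] [IsGalois ℚ L] (hL : (fInt.map (algebraMap ℤ L)).Splits) :
    1320 ∣ Nat.card Gal(L/ℚ) := by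
  have h₁₁ : 11 ^ (0 + 1) ∣ Nat.card Gal(L/ℚ) :=
    pow_dvd_card_galoisGroup L hL (p := 7) [5, 5, 6, 0, 1, 2, 0, 0, 5, 2, 6]
      [1, 5, 5, 6, 6, 5, 0, 1, 5, 5, 4] 1
      (X ^ 10 + 8 * X ^ 8 + 10 * X ^ 7 - 33 * X ^ 6 + 114 * X ^ 5 + 200 * X ^ 4 - 725 * X ^ 3
        + 1565 * X ^ 2 + 401 * X - 12) (by norm_num) (by norm_num)
      (by simp [fInt, listPoly, evalList]; ring) (by decide) (by decide +kernel)
      (by decide +kernel)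
  have h₅ : 5 ^ (0 + 1) ∣ Nat.card Gal(L/ℚ) :=
    pow_dvd_card_galoisGroup L hL (p := 13) [5, 9, 4, 6, 8, 6, 1, 11, 10, 11]
      [1, 8, 4, 8, 2, 12, 12, 2, 10, 7]
      (X - 6) (X ^ 10 - 2 * X ^ 9 + 4 * X ^ 7 - 20 * X ^ 6 + 58 * X ^ 5 + 105 * X ^ 4 - 390 * X ^ 3
        + 838 * X ^ 2 + 212 * X - 12) (by norm_num) (by norm_num)
      (by simp [fInt, listPoly, evalList]; ring) (by decide) (by decide +kernel)
      (by decide +kernel)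
  have h₃ : 3 ^ (0 + 1) ∣ Nat.card Gal(L/ℚ) :=
    pow_dvd_card_galoisGroup L hL (p := 17) [10, 9, 13] [3, 7, 11]
      (X ^ 8 - 5 * X ^ 7 + 5 * X ^ 6 - X ^ 4 - 7 * X ^ 3 + 3 * X ^ 2 - 6 * X + 3)
      (X ^ 10 - 3 * X ^ 9 + 4 * X ^ 8 + 3 * X ^ 7 - 10 * X ^ 6 + 42 * X ^ 5 + 80 * X ^ 4
        - 306 * X ^ 3 + 645 * X ^ 2 + 162 * X - 3) (by norm_num) (by norm_num)
      (by simp [fInt, listPoly, evalList]; ring) (by decide) (by decide +kernel)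
      (by decide +kernel)
  have h₂ : 2 ^ (2 + 1) ∣ Nat.card Gal(L/ℚ) :=
    pow_dvd_card_galoisGroup L hL (p := 59) [16, 5, 29, 6, 42, 23, 26, 14]
      [35, 5, 4, 0, 24, 1, 41, 34]
      (X ^ 3 + 18 * X ^ 2 - 7 * X - 2)
      (5 * X ^ 9 + X ^ 8 + 9 * X ^ 7 - 5 * X ^ 6 + 25 * X ^ 5 + 26 * X ^ 4 - 82 * X ^ 3
        + 186 * X ^ 2 + 45 * X - 2) (by norm_num) (by norm_num)
      (by simp [fInt, listPoly, evalList]; ring) (by decide) (by decide +kernel)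
      (by decide +kernel)
  exact Nat.Coprime.mul_dvd_of_dvd_of_dvd (m := 165) (n := 8) (by norm_num)
    (Nat.Coprime.mul_dvd_of_dvd_of_dvd (m := 55) (n := 3) (by norm_num)
      (Nat.Coprime.mul_dvd_of_dvd_of_dvd (by norm_num) h₁₁ h₅) h₃) h₂

lemma norm_le_one_of_isIntegral {p : ℕ} [Fact p.Prime] {x : ℚ_[p]} (hx : IsIntegral ℤ x) :
    ‖x‖ ≤ 1 := by
  obtain ⟨y, rfl⟩ := IsIntegrallyClosed.isIntegral_iff.1 (hx.tower_top (A := ℤ_[p]))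
  exact y.2

/-- An algebraic integer all of whose complex absolute values are bounded and many of whose
conjugates are `p`-adically small is zero. -/
lemma eq_zero_of_small {L : Type*} [Field L] [CharZero L] [Algebra ℚ L] [FiniteDimensional ℚ L]
    [IsGalois ℚ L] {p : ℕ} [Fact p.Prime] (φ : L →+* ℚ_[p]) {θ : L} (hθ : IsIntegral ℤ θ)
    {a b m : ℕ} (hb : ∀ ι : L →+* ℂ, ‖ι θ‖ ≤ b) (S : Subgroup Gal(L/ℚ)) (hS : S.index ≤ m)
    (ha : ∀ g ∈ S, ‖φ (g θ)‖ ≤ (p : ℝ) ^ (-(a : ℤ))) (hlt : b ^ m < p ^ a) : θ = 0 := by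
  classical
  have hint : ∀ g : Gal(L/ℚ), IsIntegral ℤ (g θ) := fun g ↦ hθ.map (g.toRingEquiv.toRingHom.toIntAlgHom)
  obtain ⟨z, hz⟩ := IsIntegrallyClosed.isIntegral_iff.1 (Algebra.isIntegral_norm ℚ hθ)
  have hprod : (z : L) = ∏ g : Gal(L/ℚ), g θ := by
    rw [← Algebra.norm_eq_prod_automorphisms, ← hz]
    simp
  suffices hz0 : z = 0 by
    rw [← Algebra.norm_eq_zero_iff (R := ℚ), ← hz, hz0, map_zero]
  by_contra hz0
  have harch : z.natAbs ≤ b ^ Nat.card Gal(L/ℚ) := by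
    have h : ‖((z : ℤ) : ℂ)‖ ≤ (b : ℝ) ^ Nat.card Gal(L/ℚ) := by
      let ι : L →+* ℂ := (IsAlgClosed.lift : L →ₐ[ℚ] ℂ).toRingHom
      rw [← map_intCast ι, hprod, map_prod, norm_prod, Nat.card_eq_fintype_card, ← Finset.card_univ,
        ← Finset.prod_const]
      exact Finset.prod_le_prod (fun _ _ ↦ norm_nonneg _)
        fun g _ ↦ hb (ι.comp g.toRingEquiv.toRingHom)
    rw [Complex.norm_intCast, ← Int.cast_abs, ← Int.natCast_natAbs] at h
    exact_mod_cast h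
  have hadic : (p ^ (a * Nat.card S) : ℤ) ∣ z := by
    have h : ‖((z : ℤ) : ℚ_[p])‖ ≤ (p : ℝ) ^ (-((a * Nat.card S : ℕ) : ℤ)) := by
      rw [← map_intCast φ, hprod, map_prod, norm_prod]
      have hle : ∀ g : Gal(L/ℚ), ‖φ (g θ)‖ ≤ if g ∈ S then (p : ℝ) ^ (-(a : ℤ)) else 1 := by
        intro g
        split_ifs with hg
        · exact ha g hg
        · exact norm_le_one_of_isIntegral ((hint g).map φ.toIntAlgHom)
      refine (Finset.prod_le_prod (fun _ _ ↦ norm_nonneg _) fun g _ ↦ hle g).trans_eq ?_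
      rw [Finset.prod_ite, Finset.prod_const_one, mul_one, Finset.prod_const]
      have hcard : (Finset.univ.filter (· ∈ S)).card = Nat.card S := by
        rw [Nat.card_eq_fintype_card, Fintype.card_subtype]
      rw [hcard, ← zpow_natCast, ← zpow_mul]
      congr 1
      push_cast
      ring
    exact_mod_cast (Padic.norm_int_le_pow_iff_dvd _ _).1 h
  have hle : p ^ (a * Nat.card S) ≤ z.natAbs :=
    Nat.le_of_dvd (Int.natAbs_pos.2 hz0) (by simpa [Int.natAbs_pow] using Int.natAbs_dvd_natAbs.2 hadic)
  have hb0 : 0 < b := by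
    by_contra! h0
    obtain rfl : b = 0 := by omega
    rw [zero_pow Nat.card_pos.ne'] at harch
    omega
  have hcard : Nat.card Gal(L/ℚ) ≤ m * Nat.card S := by
    rw [← S.index_mul_card]
    gcongr
  have := calc
    b ^ Nat.card Gal(L/ℚ) ≤ b ^ (m * Nat.card S) := Nat.pow_le_pow_right hb0 hcard
    _ = (b ^ m) ^ Nat.card S := pow_mul _ _ _
    _ < (p ^ a) ^ Nat.card S := Nat.pow_lt_pow_left hlt Nat.card_pos.ne'
    _ = p ^ (a * Nat.card S) := (pow_mul _ _ _).symm
  omega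

lemma norm_root_le {z : ℂ} (hz : aeval z fInt = 0) : ‖z‖ ≤ 6 := by
  by_contra! h
  obtain ⟨s, hs, hr⟩ : ∃ s : ℝ, 0 < s ∧ ‖z‖ = 6 + s := ⟨‖z‖ - 6, by linarith, by ring⟩
  have hz' : z ^ 11 = -2 * z ^ 10 + 5 * z ^ 9 + -50 * z ^ 8 + -70 * z ^ 7 + 232 * z ^ 6
      + -796 * z ^ 5 + -1400 * z ^ 4 + 5075 * z ^ 3 + -10950 * z ^ 2 + -2805 * z + 90 := by
    simp [fInt, map_ofNat] at hz
    linear_combination hz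
  have hle : ‖z ^ 11‖ ≤ 2 * ‖z‖ ^ 10 + 5 * ‖z‖ ^ 9 + 50 * ‖z‖ ^ 8 + 70 * ‖z‖ ^ 7 + 232 * ‖z‖ ^ 6
      + 796 * ‖z‖ ^ 5 + 1400 * ‖z‖ ^ 4 + 5075 * ‖z‖ ^ 3 + 10950 * ‖z‖ ^ 2 + 2805 * ‖z‖ + 90 := by
    rw [hz']
    refine norm_add_le_of_le ?_ (by simp)
    iterate 9 refine norm_add_le_of_le ?_ (by simp)
    simp
  rw [norm_pow, hr, ← sub_nonpos] at hle
  refine hle.not_gt ?_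
  ring_nf
  positivity

lemma norm_steinerForm_le {x : Fin 11 → ℂ} (hx : ∀ i, ‖x i‖ ≤ 6) :
    ‖steinerForm x + 548‖ ≤ 513764 := by
  have h : ‖steinerForm x‖ ≤ ∑ _s : Fin 11, (6 : ℝ) * 6 *
      (6 * (6 * 6 + 6 * 6 + 6 * 6) + 6 * (6 * 6 + 6 * 6) + 6 * 6 * 6) :=
    norm_sum_le_of_le _ fun s _ ↦ by apply_rules [norm_add_le_of_le, norm_mul_le_of_le, hx]
  refine (norm_add_le_of_le h (by simp : ‖(548 : ℂ)‖ ≤ 548)).trans_eq ?_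
  norm_num

lemma natDegree_fInt : fInt.natDegree = 11 := by
  unfold fInt
  compute_degree!

section

variable {R : Type*} [CommRing R] [IsDomain R] {x : Fin 11 → R}

lemma roots_fInt_eq (hx : Function.Injective x) (h : ∀ i, aeval (x i) fInt = 0) :
    (fInt.map (algebraMap ℤ R)).roots = Finset.univ.val.map x := by
  have hle : Finset.univ.val.map x ≤ (fInt.map (algebraMap ℤ R)).roots := by
    refine (Multiset.le_iff_subset (Finset.univ.nodup.map hx)).2 fun y hy ↦ ?_
    obtain ⟨i, -, rfl⟩ := Multiset.mem_map.1 hy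
    rw [mem_roots (monic_fInt.map _).ne_zero, IsRoot.def, eval_map_algebraMap, h]
  refine (Multiset.eq_of_le_of_card_le hle ?_).symm
  refine (card_roots' _).trans ?_
  rw [monic_fInt.natDegree_map, natDegree_fInt]
  simp

lemma splits_fInt_of_roots (hx : Function.Injective x) (h : ∀ i, aeval (x i) fInt = 0) :
    (fInt.map (algebraMap ℤ R)).Splits := by
  rw [splits_iff_card_roots, roots_fInt_eq hx h, monic_fInt.natDegree_map, natDegree_fInt]
  simp

lemma exists_eq_of_aeval_fInt (hx : Function.Injective x) (h : ∀ i, aeval (x i) fInt = 0) {y : R}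
    (hy : aeval y fInt = 0) : ∃ i, x i = y := by
  have hmem : y ∈ (fInt.map (algebraMap ℤ R)).roots := by
    rw [mem_roots (monic_fInt.map _).ne_zero, IsRoot.def, eval_map_algebraMap, hy]
  rw [roots_fInt_eq hx h] at hmem
  obtain ⟨i, -, hi⟩ := Multiset.mem_map.1 hmem
  exact ⟨i, hi⟩

end

lemma disjoint_steinerGroup_fixFour : Disjoint steinerGroup fixFour := by
  rw [Subgroup.disjoint_def]
  intro τ hM hτ
  refine eq_one_of_steinerForm_residue hτ ?_
  have h := hM ℤ fun i ↦ residue i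
  have hcast := fun y : Fin 11 → ℕ ↦ map_steinerForm (Nat.castRingHom ℤ) y
  simp only [Nat.coe_castRingHom] at hcast
  rw [← hcast residue, ← hcast fun i ↦ residue (τ i), Nat.cast_inj] at h
  rw [h]
  decide +kernel

lemma index_steinerGroup : steinerGroup.index = 5040 := by
  have h := steinerGroup.card_mul_index
  rw [card_eq_of_disjoint rot_mem_steinerGroup twist_mem_steinerGroup
    disjoint_steinerGroup_fixFour, Nat.card_perm, Nat.card_fin] at h
  have : Nat.factorial 11 = 7920 * 5040 := by decide +kernel
  omega

/-- The permutation of the roots of a polynomial induced by an automorphism. -/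
lemma exists_permHom {K L ι : Type*} [Field K] [Field L] [Algebra K L] [Finite ι] {x : ι → L}
    (hx : Function.Injective x) (h : ∀ (g : Gal(L/K)) i, ∃ j, x j = g (x i)) :
    ∃ ψ : Gal(L/K) →* Equiv.Perm ι, ∀ g i, x (ψ g i) = g (x i) := by
  have hperm : ∀ g : Gal(L/K), ∃ σ : Equiv.Perm ι, ∀ i, x (σ i) = g (x i) := fun g ↦ by
    choose s hs using h g
    have hinj : Function.Injective s := fun i j hij ↦
      hx (g.injective (by rw [← hs, ← hs, hij]))
    exact ⟨Equiv.ofBijective s (Finite.injective_iff_bijective.1 hinj), hs⟩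
  choose ψ hψ using hperm
  refine ⟨MonoidHom.mk' ψ fun g₁ g₂ ↦ Equiv.ext fun i ↦ hx ?_, hψ⟩
  rw [hψ, Equiv.Perm.mul_apply, hψ, hψ, AlgEquiv.mul_apply]

/-- The roots in a field where the polynomial splits, numbered by means of an embedding into the
`11047`-adic numbers. -/
lemma exists_root_numbering {L : Type*} [Field L] (hL : (fInt.map (algebraMap ℤ L)).Splits)
    (φ : L →+* ℚ_[11047]) : ∃ x : Fin 11 → L, ∀ i, φ (x i) = padicRoot i := by
  have h : ∀ i, (padicRoot i : ℚ_[11047]) ∈ φ.range := fun i ↦ by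
    refine hL.mem_range_of_isRoot (monic_fInt.map _).ne_zero ?_
    rw [Polynomial.map_map, RingHom.ext_int (φ.comp _) (algebraMap ℤ _), IsRoot.def,
      eval_map_algebraMap]
    have := congrArg (algebraMap ℤ_[11047] ℚ_[11047]) (aeval_padicRoot i)
    rwa [map_zero, ← aeval_algebraMap_apply] at this
  choose x hx using h
  exact ⟨x, hx⟩

lemma bound_lt_precision : 513764 ^ 5040 < 11047 ^ precision := by decide +kernel

section

variable {L : Type} [Field L] [Algebra ℚ L] {φ : L →+* ℚ_[11047]} {x : Fin 11 → L}
  {ψ : Gal(L/ℚ) →* Equiv.Perm (Fin 11)}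

lemma map_map_steinerForm (hx : ∀ i, φ (x i) = padicRoot i) (hψ : ∀ g i, x (ψ g i) = g (x i))
    (g : Gal(L/ℚ)) :
    φ (g (steinerForm x)) = (steinerForm (fun i ↦ padicRoot (ψ g i)) : ℤ_[11047]) := by
  have h₁ := map_steinerForm (φ.comp g.toRingEquiv.toRingHom) x
  have h₂ := map_steinerForm (algebraMap ℤ_[11047] ℚ_[11047]) fun i ↦ padicRoot (ψ g i)
  refine h₁.trans (Eq.trans ?_ h₂.symm)
  congr 1
  funext i
  change φ (g (x i)) = (padicRoot (ψ g i) : ℚ_[11047])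
  rw [← hψ, hx]

variable [CharZero L] [FiniteDimensional ℚ L] [IsGalois ℚ L]

lemma steinerForm_eq (hroot : ∀ i, aeval (x i) fInt = 0) (hx : ∀ i, φ (x i) = padicRoot i)
    (hψ : ∀ g i, x (ψ g i) = g (x i)) : steinerForm x = -548 := by
  have hx_int : ∀ i, IsIntegral ℤ (x i) := fun i ↦ ⟨fInt, monic_fInt, hroot i⟩
  rw [← add_eq_zero_iff_eq_neg]
  refine eq_zero_of_small (a := precision) (b := 513764) (m := 5040) φ ?_ (fun ι ↦ ?_)
    (steinerGroup.comap ψ) ?_ (fun g hg ↦ ?_) bound_lt_precision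
  · have h := map_steinerForm (algebraMap (integralClosure ℤ L) L) fun i ↦ ⟨x i, hx_int i⟩
    have hmem : steinerForm x ∈ integralClosure ℤ L := h ▸ Subtype.property _
    exact add_mem hmem (ofNat_mem _ 548)
  · rw [map_add, map_ofNat, map_steinerForm]
    refine (norm_steinerForm_le fun i ↦ norm_root_le ?_).trans_eq (by norm_num)
    have := congrArg ι.toIntAlgHom (hroot i)
    rwa [map_zero, ← aeval_algHom_apply] at this
  · rw [Subgroup.index_comap, ← index_steinerGroup, ← Subgroup.relIndex_top_right]
    exact Subgroup.relIndex_le_of_le_right le_top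
      (by rw [Subgroup.relIndex_top_right, index_steinerGroup]; norm_num)
  · rw [map_add, map_add, map_map_steinerForm hx hψ, hg, map_ofNat, map_ofNat]
    exact_mod_cast norm_steinerForm_padicRoot

lemma range_le_steinerGroup (hroot : ∀ i, aeval (x i) fInt = 0)
    (hx : ∀ i, φ (x i) = padicRoot i) (hψ : ∀ g i, x (ψ g i) = g (x i)) :
    ψ.range ≤ steinerGroup := by
  rintro _ ⟨g, rfl⟩
  have h : steinerForm (fun i ↦ padicRoot (ψ g i)) = -548 := by
    have := map_map_steinerForm hx hψ g
    rw [steinerForm_eq hroot hx hψ, map_neg, map_neg, map_ofNat, map_ofNat] at this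
    exact Subtype.val_injective (this.symm.trans (by push_cast; rfl))
  obtain ⟨k, hk, hτ⟩ := exists_mul_mem_fixFour rot_mem_steinerGroup twist_mem_steinerGroup (ψ g)⁻¹
  have hτ' := eq_one_of_steinerForm_padicRoot (fixFour.inv_mem hτ) (by
    rw [mul_inv_rev, inv_inv, ← h]
    exact (steinerGroup.inv_mem hk) ℤ_[11047] fun i ↦ padicRoot (ψ g i))
  rw [mul_inv_rev, inv_inv, mul_inv_eq_one] at hτ'
  rwa [hτ']

end

lemma card_galoisGroup_fInt (L : Type) [Field L] [CharZero L] [Algebra ℚ L]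
    [FiniteDimensional ℚ L] [IsGalois ℚ L] [IsSplittingField ℚ L (fInt.map (algebraMap ℤ ℚ))] :
    Nat.card Gal(L/ℚ) = 7920 := by
  have hmap : ∀ (R : Type) [CommRing R] [Algebra ℚ R],
      (fInt.map (algebraMap ℤ ℚ)).map (algebraMap ℚ R) = fInt.map (algebraMap ℤ R) := by
    intro R _ _
    rw [Polynomial.map_map, RingHom.ext_int (RingHom.comp _ _) (algebraMap ℤ R)]
  have hL : (fInt.map (algebraMap ℤ L)).Splits :=
    hmap L ▸ IsSplittingField.splits L (fInt.map (algebraMap ℤ ℚ))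
  have hsplit : (fInt.map (algebraMap ℤ ℚ_[11047])).Splits := by
    refine splits_fInt_of_roots (x := fun i ↦ (padicRoot i : ℚ_[11047]))
      (Subtype.val_injective.comp padicRoot_injective) fun i ↦ ?_
    have := congrArg (algebraMap ℤ_[11047] ℚ_[11047]) (aeval_padicRoot i)
    rwa [map_zero, ← aeval_algebraMap_apply] at this
  let φ : L →+* ℚ_[11047] := (IsSplittingField.lift L (fInt.map (algebraMap ℤ ℚ))
    (hmap ℚ_[11047] ▸ hsplit)).toRingHom
  obtain ⟨x, hx⟩ := exists_root_numbering hL φ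
  have hinj : Function.Injective x := fun i j hij ↦
    padicRoot_injective (Subtype.val_injective (by rw [← hx, ← hx, hij]))
  have hroot : ∀ i, aeval (x i) fInt = 0 := fun i ↦ by
    refine φ.injective ?_
    have h := aeval_algHom_apply φ.toIntAlgHom (x i) fInt
    have h' := congrArg (algebraMap ℤ_[11047] ℚ_[11047]) (aeval_padicRoot i)
    rw [← aeval_algebraMap_apply] at h'
    refine h.symm.trans ?_
    rw [map_zero] at h' ⊢
    change aeval (φ (x i)) fInt = 0
    rwa [hx]
  obtain ⟨ψ, hψ⟩ := exists_permHom (K := ℚ) hinj fun g i ↦ by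
    refine exists_eq_of_aeval_fInt hinj hroot ?_
    have := congrArg g.toRingEquiv.toRingHom.toIntAlgHom (hroot i)
    rwa [map_zero, ← aeval_algHom_apply] at this
  have hψ_inj : Function.Injective ψ := by
    rw [injective_iff_map_eq_one]
    intro g hg
    have hadj := IsSplittingField.adjoin_rootSet L (fInt.map (algebraMap ℤ ℚ))
    have hg' : (g : L →ₐ[ℚ] L) = AlgHom.id ℚ L := by
      refine AlgHom.ext_of_adjoin_eq_top hadj fun y hy ↦ ?_
      have hy' := (mem_rootSet.1 hy).2
      rw [aeval_map_algebraMap] at hy'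
      obtain ⟨i, rfl⟩ := exists_eq_of_aeval_fInt hinj hroot hy'
      exact (by rw [← hψ, hg]; rfl : g (x i) = x i)
    exact AlgEquiv.ext fun y ↦ DFunLike.congr_fun hg' y
  have hcard : Nat.card ψ.range = Nat.card Gal(L/ℚ) :=
    (Nat.card_congr (MonoidHom.ofInjective hψ_inj).toEquiv).symm
  rw [← hcard]
  refine card_eq_of_le rot_mem_steinerGroup twist_mem_steinerGroup disjoint_steinerGroup_fixFour
    (range_le_steinerGroup hroot hx hψ) ?_
  rw [hcard]
  exact dvd_card_galoisGroup_fInt L hL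

lemma card_gal_eq {F : Type} [Field F] [CharZero F] (f : F[X]) :
    IsGalois F f.SplittingField ∧ Nat.card f.Gal = Nat.card Gal(f.SplittingField/F) :=
  have : Normal F f.SplittingField := Normal.of_isSplittingField f
  ⟨⟨⟩, rfl⟩

/-- The Galois group over `ℚ` of
`x¹¹ + 2x¹⁰ - 5x⁹ + 50x⁸ + 70x⁷ - 232x⁶ + 796x⁵ + 1400x⁴ - 5075x³ + 10950x² + 2805x - 90`
has order `7920`, the order of the Mathieu group `M₁₁`. -/
theorem galois_group_of_f11_has_card_M11 :
    let f : Polynomial ℚ :=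
      X ^ 11 + 2 * X ^ 10 - 5 * X ^ 9 + 50 * X ^ 8 + 70 * X ^ 7 - 232 * X ^ 6
        + 796 * X ^ 5 + 1400 * X ^ 4 - 5075 * X ^ 3 + 10950 * X ^ 2 + 2805 * X - 90
    Nat.card f.Gal = 7920 := by
  intro f
  have hf : f = fInt.map (algebraMap ℤ ℚ) := by
    simp [f, fInt]
  clear_value f
  have hs := IsSplittingField.splittingField f
  obtain ⟨hgal, hcard⟩ := card_gal_eq f
  rw [hcard]
  subst hf
  exact @card_galoisGroup_fInt _ _ _ _ _ hgal hs
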